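/- arXiv:1811.04410 — 3 statements merged into one kernel-verified Lean document; each statement's English description precedes it below -/
import Mathlib

section
/- Let n ≥ 3 and 0 < m < (n-2)/n. Then: (a) if (n-2)/(n+2) ≤ m < (n-2)/n, the function β ↦ A_1(m,β) is strictly increasing on (β_0(m), ∞); (b) if (n-2)/(n+2) ≤ m < (n-2)/n, the function β ↦ A_2(m,β) is strictly decreasing on (β_0(m), ∞); (c) if (n-2)/(n+2) ≤ m < (n-2)/n and β > β_1(m), then A_1(m,β) > 0; (d) if max((n-4)/(n-2), (n-2)/(n+2)) ≤ m < (n-2)/n and β_0(m) < β < β_1(m), then A_1(m,β) < 0. -/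
open Real Filter MeasureTheory Set Topology

noncomputable section

def Cstar (n : ℕ) (m : ℝ) : ℝ := 2 * m * ((n : ℝ) - 2 - n * m) / (1 - m)

def beta1 (n : ℕ) (m : ℝ) : ℝ := 1 / ((n : ℝ) - 2 - n * m)

def betaE (n : ℕ) (m : ℝ) : ℝ := m / ((n : ℝ) - 2 - n * m)

def beta2 (n : ℕ) (m : ℝ) : ℝ :=
  Real.sqrt (2 * (1 - m) / ((n : ℝ) - 2 - n * m)) +
    (((n : ℝ) + 2) * m - ((n : ℝ) - 2)) / (2 * ((n : ℝ) - 2 - n * m))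

def beta0 (n : ℕ) (m : ℝ) : ℝ := max (beta2 n m) (betaE n m)

def A0 (n : ℕ) (m β : ℝ) : ℝ :=
  (n : ℝ) - 2 - ((n : ℝ) + 2) * m + 2 * β * ((n : ℝ) - 2 - n * m)

def gamma1 (n : ℕ) (m β : ℝ) : ℝ :=
  (A0 n m β - Real.sqrt ((A0 n m β) ^ 2 - 8 * ((n : ℝ) - 2 - n * m) * (1 - m))) / (2 * (1 - m))

def gamma2 (n : ℕ) (m β : ℝ) : ℝ :=
  (A0 n m β + Real.sqrt ((A0 n m β) ^ 2 - 8 * ((n : ℝ) - 2 - n * m) * (1 - m))) / (2 * (1 - m))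

def Acoef1 (n : ℕ) (m β : ℝ) : ℝ := 1 / (1 - m) - β * gamma1 n m β

def Acoef2 (n : ℕ) (m β : ℝ) : ℝ := 1 / (1 - m) - β * gamma2 n m β

/-- Condition (C1). -/
def CondC1 (n : ℕ) (m β : ℝ) : Prop :=
  beta1 n m < β ∨
    (4 < n ∧ 0 < m ∧ m < ((n : ℝ) - 4) / ((n : ℝ) - 2) ∧ beta0 n m < β ∧ β ≤ beta1 n m)

/-- Condition (C2). -/
def CondC2 (n : ℕ) (m β : ℝ) : Prop :=
  beta0 n m < β ∧ β < beta1 n m ∧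
    (n ≤ 4 ∨ (4 < n ∧ ((n : ℝ) - 4) / ((n : ℝ) - 2) < m ∧ m < ((n : ℝ) - 2) / n))

/-- Condition (C3). -/
def CondC3 (n : ℕ) (m β : ℝ) : Prop :=
  β = beta1 n m ∧
    (n ≤ 4 ∨ (4 < n ∧ ((n : ℝ) - 4) / ((n : ℝ) - 2) < m ∧ m < ((n : ℝ) - 2) / n))

/-- A self-similar profile `f = f_lam`. -/
structure IsProfile (n : ℕ) (m β α lam : ℝ) (f : ℝ → ℝ) : Prop where
  pos : ∀ r, 0 ≤ r → 0 < f r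
  smooth : ContDiffOn ℝ 2 f (Set.Ici 0)
  ode : ∀ r, 0 < r →
    deriv (deriv (fun s => f s ^ m)) r + (((n : ℝ) - 1) / r) * deriv (fun s => f s ^ m) r +
      α * f r + β * r * deriv f r = 0
  init : f 0 = lam ^ (2 / (1 - m))
  init' : deriv f 0 = 0
  asymp : Tendsto (fun r => r ^ 2 * f r ^ (1 - m)) atTop (nhds (Cstar n m))

/-- The Laplacian of `f : ℝ^n → ℝ`. -/
def lap (n : ℕ) (f : EuclideanSpace ℝ (Fin n) → ℝ) (x : EuclideanSpace ℝ (Fin n)) : ℝ :=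
  ∑ i : Fin n,
    fderiv ℝ (fun y => fderiv ℝ f y (EuclideanSpace.single i (1 : ℝ))) x
      (EuclideanSpace.single i (1 : ℝ))

/-- The self-similar solution `U_lam(x,t) = (T-t)^α f_lam((T-t)^β |x|)`. -/
def Uself (n : ℕ) (β α T : ℝ) (f : ℝ → ℝ) (x : EuclideanSpace ℝ (Fin n)) (t : ℝ) : ℝ :=
  (T - t) ^ α * f ((T - t) ^ β * ‖x‖)

/-- A (positive smooth) solution of the Cauchy problem `u_t = Δ(u^m)` on `ℝ^n × (0,T)` with
initial value `u0` taken in `L¹_loc`. -/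
structure IsCauchySolution (n : ℕ) (m T : ℝ) (u0 : EuclideanSpace ℝ (Fin n) → ℝ)
    (u : EuclideanSpace ℝ (Fin n) → ℝ → ℝ) : Prop where
  pos : ∀ x, ∀ t ∈ Set.Ioo 0 T, 0 < u x t
  smooth : ContDiffOn ℝ (⊤ : ℕ∞) (fun p : EuclideanSpace ℝ (Fin n) × ℝ => u p.1 p.2)
    ((Set.univ : Set (EuclideanSpace ℝ (Fin n))) ×ˢ Set.Ioo 0 T)
  pde : ∀ x, ∀ t ∈ Set.Ioo 0 T, deriv (u x) t = lap n (fun y => u y t ^ m) x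
  init : ∀ K : Set (EuclideanSpace ℝ (Fin n)), IsCompact K →
    Tendsto (fun t => ∫ x in K, |u x t - u0 x|) (nhdsWithin 0 (Set.Ioi 0)) (nhds 0)

/-- The rescaled solution `ũ(y,τ)`. -/
def resc (n : ℕ) (β α T : ℝ) (u : EuclideanSpace ℝ (Fin n) → ℝ → ℝ)
    (y : EuclideanSpace ℝ (Fin n)) (τ : ℝ) : ℝ :=
  (T * Real.exp (-τ)) ^ (-α) * u (((T * Real.exp (-τ)) ^ (-β)) • y) (T * (1 - Real.exp (-τ)))

/-- The singular profile `𝒞(y) = (C_*/|y|²)^{1/(1-m)}`. -/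
def singC (n : ℕ) (m : ℝ) (y : EuclideanSpace ℝ (Fin n)) : ℝ :=
  (Cstar n m / ‖y‖ ^ 2) ^ (1 / (1 - m))

/-- The weight exponent `p₀`. -/
def pZero (n : ℕ) (m β : ℝ) : ℝ := ((1 - m) / 2) * ((n : ℝ) - 2 / (1 - m) - gamma1 n m β)

/-- The constant `a_*`. -/
def aStar (n : ℕ) (m β : ℝ) : ℝ :=
  2 * m * pZero n m β / (Cstar n m * (1 - m)) * (gamma1 n m β + 2 * m / (1 - m))

/-- `Φ(s) = (1+w(s))^{1/m} − 1 − w(s)/m`. -/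
def Phi (m : ℝ) (w : ℝ → ℝ) (s : ℝ) : ℝ := (1 + w s) ^ (1 / m) - 1 - w s / m

end

theorem mul_sub_sqrt_lt {a b d q : ℝ} (ha : 0 < a) (hab : a < b) (hd : 0 ≤ d) (hq : 0 < q)
    (hqa : q ≤ a ^ 2) :
    (b + d) * (b - √(b ^ 2 - q)) < (a + d) * (a - √(a ^ 2 - q)) := by
  have hs := Real.sqrt_nonneg (a ^ 2 - q)
  have ht := Real.sqrt_nonneg (b ^ 2 - q)
  have hsq : √(a ^ 2 - q) ^ 2 = a ^ 2 - q := Real.sq_sqrt (by linarith)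
  have htq : √(b ^ 2 - q) ^ 2 = b ^ 2 - q := Real.sq_sqrt (by nlinarith)
  have hst : √(a ^ 2 - q) < √(b ^ 2 - q) := Real.sqrt_lt_sqrt (by linarith) (by nlinarith)
  generalize √(a ^ 2 - q) = s at *
  generalize √(b ^ 2 - q) = t at *
  have hcross : b * s < a * t := by
    apply lt_of_pow_lt_pow_left₀ 2 (by positivity)
    have h : a ^ 2 < b ^ 2 := by nlinarith
    rw [mul_pow, mul_pow, hsq, htq]
    nlinarith
  have e1 : a - s = q / (a + s) := by
    rw [eq_div_iff (by positivity)]; linarith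
  have e2 : b - t = q / (b + t) := by
    rw [eq_div_iff (by linarith)]; linarith
  have h1 : b - t ≤ a - s := by
    rw [e1, e2]
    gcongr
  have h2 : b * (b - t) < a * (a - s) := by
    rw [e1, e2, ← mul_div_assoc, ← mul_div_assoc, div_lt_div_iff₀ (by linarith) (by positivity)]
    nlinarith
  nlinarith

theorem mul_add_sqrt_lt {a b d q : ℝ} (ha : 0 < a) (hab : a < b) (hd : 0 ≤ d) :
    (a + d) * (a + √(a ^ 2 - q)) < (b + d) * (b + √(b ^ 2 - q)) := by
  have hs := Real.sqrt_nonneg (a ^ 2 - q)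
  have hst : √(a ^ 2 - q) ≤ √(b ^ 2 - q) := Real.sqrt_le_sqrt (by nlinarith)
  apply mul_lt_mul'' <;> linarith

section

variable {n : ℕ} {m : ℝ}

theorem A0_bounds_of_beta0_lt (hk : 0 < (n : ℝ) - 2 - n * m) (hc : 0 < 1 - m) {β : ℝ}
    (h : beta0 n m < β) :
    0 < A0 n m β ∧ 8 * ((n : ℝ) - 2 - n * m) * (1 - m) ≤ A0 n m β ^ 2 := by
  have h2 : beta2 n m < β := lt_of_le_of_lt (le_max_left _ _) h
  unfold beta2 at h2
  unfold A0
  generalize (n : ℝ) - 2 - n * m = k at *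
  have hr : 0 < √(2 * (1 - m) / k) := Real.sqrt_pos.2 (by positivity)
  have hr2 : √(2 * (1 - m) / k) ^ 2 * k = 2 * (1 - m) := by
    rw [Real.sq_sqrt (by positivity)]; field_simp
  generalize √(2 * (1 - m) / k) = r at *
  have h3 : 2 * k * r < (n : ℝ) - 2 - (n + 2) * m + 2 * β * k := by
    have h4 := mul_lt_mul_of_pos_right h2 (by positivity : 0 < 2 * k)
    rw [add_mul, div_mul_cancel₀ _ (by positivity)] at h4
    linarith
  have h5 : 0 < 2 * k * r := by positivity
  refine ⟨h5.trans h3, ?_⟩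
  calc 8 * k * (1 - m) = (2 * k * r) ^ 2 := by linear_combination (-4 * k) * hr2
    _ ≤ _ := by gcongr

theorem Acoef1_eq (hk : 0 < (n : ℝ) - 2 - n * m) (hc : 0 < 1 - m) (β : ℝ) :
    Acoef1 n m β = 1 / (1 - m) - (A0 n m β + ((n + 2) * m - (n - 2))) *
      (A0 n m β - √(A0 n m β ^ 2 - 8 * ((n : ℝ) - 2 - n * m) * (1 - m))) /
      (4 * ((n : ℝ) - 2 - n * m) * (1 - m)) := by
  have hβ : A0 n m β + ((n + 2) * m - (n - 2)) = 2 * β * ((n : ℝ) - 2 - n * m) := by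
    unfold A0; ring
  rw [hβ, Acoef1, gamma1]
  generalize (n : ℝ) - 2 - n * m = k at *
  field_simp
  ring

theorem Acoef2_eq (hk : 0 < (n : ℝ) - 2 - n * m) (hc : 0 < 1 - m) (β : ℝ) :
    Acoef2 n m β = 1 / (1 - m) - (A0 n m β + ((n + 2) * m - (n - 2))) *
      (A0 n m β + √(A0 n m β ^ 2 - 8 * ((n : ℝ) - 2 - n * m) * (1 - m))) /
      (4 * ((n : ℝ) - 2 - n * m) * (1 - m)) := by
  have hβ : A0 n m β + ((n + 2) * m - (n - 2)) = 2 * β * ((n : ℝ) - 2 - n * m) := by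
    unfold A0; ring
  rw [hβ, Acoef2, gamma2]
  generalize (n : ℝ) - 2 - n * m = k at *
  field_simp
  ring

theorem A0_lt_A0 (hk : 0 < (n : ℝ) - 2 - n * m) {β β' : ℝ} (h : β < β') :
    A0 n m β < A0 n m β' := by
  unfold A0
  gcongr

theorem Acoef1_lt_Acoef1 (hk : 0 < (n : ℝ) - 2 - n * m) (hc : 0 < 1 - m)
    (hd : (n : ℝ) - 2 ≤ (n + 2) * m) {β β' : ℝ} (hA : 0 < A0 n m β)
    (hA2 : 8 * ((n : ℝ) - 2 - n * m) * (1 - m) ≤ A0 n m β ^ 2) (h : β < β') :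
    Acoef1 n m β < Acoef1 n m β' := by
  rw [Acoef1_eq hk hc, Acoef1_eq hk hc]
  have := mul_sub_sqrt_lt hA (A0_lt_A0 hk h) (sub_nonneg.2 hd) (by positivity) hA2
  gcongr

theorem Acoef2_lt_Acoef2 (hk : 0 < (n : ℝ) - 2 - n * m) (hc : 0 < 1 - m)
    (hd : (n : ℝ) - 2 ≤ (n + 2) * m) {β β' : ℝ} (hA : 0 < A0 n m β) (h : β < β') :
    Acoef2 n m β' < Acoef2 n m β := by
  rw [Acoef2_eq hk hc, Acoef2_eq hk hc]
  have := mul_add_sqrt_lt (q := 8 * ((n : ℝ) - 2 - n * m) * (1 - m)) hA (A0_lt_A0 hk h)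
    (sub_nonneg.2 hd)
  gcongr

theorem A0_beta1 (hk : 0 < (n : ℝ) - 2 - n * m) :
    A0 n m (beta1 n m) = (n : ℝ) - 2 - n * m + 2 * (1 - m) := by
  unfold A0 beta1
  rw [mul_assoc, one_div, inv_mul_cancel₀ hk.ne']
  ring

theorem Acoef1_beta1 (hk : 0 < (n : ℝ) - 2 - n * m) (hc : 0 < 1 - m) :
    Acoef1 n m (beta1 n m) =
      ((n : ℝ) - 2 - n * m - 2 * (1 - m) + |(n : ℝ) - 2 - n * m - 2 * (1 - m)|) /
        (2 * ((n : ℝ) - 2 - n * m) * (1 - m)) := by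
  rw [Acoef1, gamma1, A0_beta1 hk, beta1]
  generalize (n : ℝ) - 2 - n * m = k at *
  rw [show (k + 2 * (1 - m)) ^ 2 - 8 * k * (1 - m) = (k - 2 * (1 - m)) ^ 2 by ring,
    Real.sqrt_sq_eq_abs]
  field_simp
  ring

end

/-- Monotonicity and sign properties of `A₁(m,β)` and `A₂(m,β)` in `β`. -/
theorem Acoef_monotonicity (n : ℕ) (m : ℝ) (hn : 3 ≤ n) (hm0 : 0 < m)
    (hm1 : m < ((n : ℝ) - 2) / n) :
    (((n : ℝ) - 2) / ((n : ℝ) + 2) ≤ m → StrictMonoOn (Acoef1 n m) (Set.Ioi (beta0 n m))) ∧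
    (((n : ℝ) - 2) / ((n : ℝ) + 2) ≤ m → StrictAntiOn (Acoef2 n m) (Set.Ioi (beta0 n m))) ∧
    (((n : ℝ) - 2) / ((n : ℝ) + 2) ≤ m → ∀ β : ℝ, beta1 n m < β → 0 < Acoef1 n m β) ∧
    (max (((n : ℝ) - 4) / ((n : ℝ) - 2)) (((n : ℝ) - 2) / ((n : ℝ) + 2)) ≤ m →
      ∀ β : ℝ, beta0 n m < β → β < beta1 n m → Acoef1 n m β < 0) := by
  have hn' : (3 : ℝ) ≤ n := by exact_mod_cast hn
  have hk : 0 < (n : ℝ) - 2 - n * m := by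
    rw [lt_div_iff₀ (by linarith)] at hm1
    linarith
  have hc : 0 < 1 - m := by nlinarith
  have hd (h : ((n : ℝ) - 2) / ((n : ℝ) + 2) ≤ m) : (n : ℝ) - 2 ≤ (n + 2) * m := by
    rw [div_le_iff₀ (by linarith)] at h
    linarith
  refine ⟨fun h β hβ β' _ hlt => ?_, fun h β hβ β' _ hlt => ?_, fun h β hβ => ?_,
    fun h β hβ hβ1 => ?_⟩
  · obtain ⟨hA, hA2⟩ := A0_bounds_of_beta0_lt hk hc hβ
    exact Acoef1_lt_Acoef1 hk hc (hd h) hA hA2 hlt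
  · exact Acoef2_lt_Acoef2 hk hc (hd h) (A0_bounds_of_beta0_lt hk hc hβ).1 hlt
  · have h1 : 0 ≤ Acoef1 n m (beta1 n m) := by
      rw [Acoef1_beta1 hk hc]
      refine div_nonneg ?_ (by positivity)
      linarith [neg_abs_le ((n : ℝ) - 2 - n * m - 2 * (1 - m))]
    refine h1.trans_lt (Acoef1_lt_Acoef1 hk hc (hd h) ?_ ?_ hβ)
    · rw [A0_beta1 hk]
      positivity
    · rw [A0_beta1 hk]
      linarith [sq_nonneg ((n : ℝ) - 2 - n * m - 2 * (1 - m))]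
  · obtain ⟨h4, h2⟩ := max_le_iff.1 h
    obtain ⟨hA, hA2⟩ := A0_bounds_of_beta0_lt hk hc hβ
    refine (Acoef1_lt_Acoef1 hk hc (hd h2) hA hA2 hβ1).trans_eq ?_
    rw [div_le_iff₀ (by linarith)] at h4
    rw [Acoef1_beta1 hk hc, abs_of_nonpos (by linarith), add_neg_cancel, zero_div]
end

section
/- Let β > β_0(m), let w be as in the context, and set C_0 = C_*/(γ_2(m,β) − γ_1(m,β)). Then: (a) if A_1(m,β) ≠ 0, then lim_{s→∞} e^{γ_1 s} w(s) = −C_0 A_1(m,β) I_1; (b) if A_1(m,β) = 0 and A_2(m,β) < 0, then lim_{s→∞} e^{γ_2 s} w(s) = C_0 A_2(m,β) I_2 < 0. -/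
open Real Filter MeasureTheory Set Topology

noncomputable section

/-- If `w` converges at `-∞`, its derivative tends to `0` along some path to `-∞`. -/
lemma exists_tendsto_deriv_zero_atBot {w w' : ℝ → ℝ} {L : ℝ} (hw : ∀ s, HasDerivAt w (w' s) s)
    (hL : Tendsto w atBot (𝓝 L)) :
    ∃ c : ℝ → ℝ, Tendsto c atBot atBot ∧ Tendsto (fun s => w' (c s)) atBot (𝓝 0) := by
  have key : ∀ s : ℝ, ∃ c ∈ Ioo (s - 1) s, w' c = (w s - w (s - 1)) / (s - (s - 1)) := fun s =>
    exists_hasDerivAt_eq_slope w w' (by linarith)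
      (fun x _ => (hw x).continuousAt.continuousWithinAt) (fun x _ => hw x)
  choose c hc hc' using key
  refine ⟨c, tendsto_atBot_mono (fun s => (hc s).2.le) tendsto_id, ?_⟩
  have h1 : Tendsto (fun s : ℝ => w (s - 1)) atBot (𝓝 L) :=
    hL.comp (tendsto_atBot_add_const_right atBot (-1) tendsto_id)
  simpa [hc'] using hL.sub h1

lemma tendsto_exp_mul_atBot {γ : ℝ} (hγ : 0 < γ) :
    Tendsto (fun s : ℝ => exp (γ * s)) atBot (𝓝 0) :=
  tendsto_exp_atBot.comp (tendsto_id.const_mul_atBot hγ)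

lemma integrableOn_Iic_exp_mul {γ L : ℝ} {h : ℝ → ℝ} (hγ : 0 < γ) (hc : Continuous h)
    (hL : Tendsto h atBot (𝓝 L)) (s : ℝ) :
    IntegrableOn (fun t => exp (γ * t) * h t) (Iic s) := by
  have hloc : LocallyIntegrableOn (fun t => exp (γ * t) * h t) (Iic s) :=
    (by fun_prop : Continuous fun t => exp (γ * t) * h t).locallyIntegrable.locallyIntegrableOn _
  refine hloc.integrableOn_of_isBigO_atBot (g := fun t => exp (γ * t)) ?_ ?_
  · simpa using (Asymptotics.isBigO_refl (fun t => exp (γ * t)) atBot).mul (hL.isBigO_one ℝ)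
  · exact ⟨Iic 0, Iic_mem_atBot 0, integrableOn_exp_mul_Iic hγ 0⟩

/-- Variation of constants from `-∞` for a factored second order linear equation. -/
lemma exp_mul_eq_integral_Iic {γ δ p q L M : ℝ} {w w' w'' h h' : ℝ → ℝ} (hγ : 0 < γ)
    (hw : ∀ s, HasDerivAt w (w' s) s) (hw' : ∀ s, HasDerivAt w' (w'' s) s)
    (hh : ∀ s, HasDerivAt h (h' s) s)
    (hode : ∀ s, w'' s + (γ + δ) * w' s + γ * δ * w s = -(p * h' s + q * h s))
    (hwL : Tendsto w atBot (𝓝 L)) (hhM : Tendsto h atBot (𝓝 M)) (s : ℝ) :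
    exp (γ * s) * (w' s + δ * w s + p * h s) =
      -(q - p * γ) * ∫ t in Iic s, exp (γ * t) * h t := by
  have hcont : Continuous h := continuous_iff_continuousAt.2 fun x => (hh x).continuousAt
  have hint := integrableOn_Iic_exp_mul hγ hcont hhM s
  set F : ℝ → ℝ := fun s => exp (γ * s) * (w' s + δ * w s + p * h s) with hF
  have hd : ∀ x, HasDerivAt F (-(q - p * γ) * (exp (γ * x) * h x)) x := by
    intro x
    have h1 : HasDerivAt (fun s => exp (γ * s)) (exp (γ * x) * γ) x := by
      simpa using ((hasDerivAt_id x).const_mul γ).exp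
    refine (h1.mul (((hw' x).add ((hw x).const_mul δ)).add ((hh x).const_mul p))).congr_deriv ?_
    simp only [Pi.add_apply]
    linear_combination exp (γ * x) * hode x
  have hlim := tendsto_limUnder_of_hasDerivAt_of_integrableOn_Iic (a := s) (fun x _ => hd x)
    (hint.const_mul _)
  obtain ⟨c, hc, hc'⟩ := exists_tendsto_deriv_zero_atBot hw hwL
  have h0 : Tendsto (fun s => F (c s)) atBot (𝓝 0) := by
    simpa using ((tendsto_exp_mul_atBot hγ).comp hc).mul
      ((hc'.add ((hwL.comp hc).const_mul δ)).add ((hhM.comp hc).const_mul p))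
  rw [tendsto_nhds_unique (hlim.comp hc) h0] at hlim
  have := integral_Iic_of_hasDerivAt_of_tendsto' (fun x _ => hd x) (hint.const_mul _) hlim
  rw [integral_const_mul, sub_zero] at this
  exact this.symm

lemma hasDerivAt_integral_Iic {f : ℝ → ℝ} (hf : Continuous f)
    (hi : ∀ s, IntegrableOn f (Iic s)) (s : ℝ) :
    HasDerivAt (fun s => ∫ t in Iic s, f t) (f s) s := by
  have h1 : (fun s => ∫ t in Iic s, f t) =
      fun s => (∫ t in Iic 0, f t) + ∫ t in (0 : ℝ)..s, f t := by
    funext x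
    rw [← intervalIntegral.integral_Iic_sub_Iic (hi 0) (hi x)]
    ring
  rw [h1]
  exact (hf.integral_hasStrictDerivAt 0 s).hasDerivAt.const_add _

/-- A quadratic Gronwall argument: if `|w|` is controlled by its own variation of constants
integral and the source term is quadratic in `w`, then the source term is integrable. -/
lemma integrable_exp_mul_of_abs_le {γ K : ℝ} {w h : ℝ → ℝ} (hγ : 0 < γ) (hK : 0 ≤ K)
    (hc : Continuous h) (h0 : ∀ s, 0 ≤ h s)
    (hi : ∀ s, IntegrableOn (fun t => exp (γ * t) * h t) (Iic s))
    (hw : ∀ s, |w s| ≤ K * (exp (-γ * s) * ∫ t in Iic s, exp (γ * t) * h t))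
    (hw0 : Tendsto w atTop (𝓝 0)) (hhw : h =O[atTop] fun s => w s ^ 2) :
    Integrable fun t => exp (γ * t) * h t := by
  have hcf : Continuous fun t => exp (γ * t) * h t := by fun_prop
  set J : ℝ → ℝ := fun s => ∫ t in Iic s, exp (γ * t) * h t with hJ
  have hJ0 : ∀ s, 0 ≤ J s := fun s =>
    setIntegral_nonneg measurableSet_Iic fun t _ => mul_nonneg (exp_pos _).le (h0 t)
  have hJd : ∀ s, HasDerivAt J (exp (γ * s) * h s) s := hasDerivAt_integral_Iic hcf hi
  obtain ⟨C, hC, hCw⟩ := hhw.exists_pos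
  have hsmall : Tendsto (fun s => C * |w s| * K) atTop (𝓝 0) := by
    simpa using (hw0.abs.const_mul C).mul_const K
  obtain ⟨S, hS⟩ := eventually_atTop.1
    (hCw.bound.and (hsmall.eventually_le_const (by positivity : (0 : ℝ) < γ / 4)))
  have hhC : ∀ s, S ≤ s → h s ≤ C * w s ^ 2 := fun s hs => by
    have := (hS s hs).1
    rwa [Real.norm_of_nonneg (h0 s), Real.norm_of_nonneg (sq_nonneg _)] at this
  have hgr : ∀ s, S ≤ s → exp (γ * s) * h s ≤ γ / 4 * J s := fun s hs => by
    have e1 : exp (γ * s) * |w s| ≤ K * J s := by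
      calc exp (γ * s) * |w s| ≤ exp (γ * s) * (K * (exp (-γ * s) * J s)) := by gcongr; exact hw s
        _ = K * J s * (exp (γ * s) * exp (-γ * s)) := by ring
        _ = K * J s := by rw [← exp_add]; simp
    calc exp (γ * s) * h s ≤ exp (γ * s) * (C * w s ^ 2) := by gcongr; exact hhC s hs
      _ = C * |w s| * (exp (γ * s) * |w s|) := by rw [← sq_abs]; ring
      _ ≤ C * |w s| * (K * J s) := by gcongr
      _ = C * |w s| * K * J s := by ring
      _ ≤ γ / 4 * J s := mul_le_mul_of_nonneg_right (hS s hs).2 (hJ0 s)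
  have hDd : ∀ x, HasDerivAt (fun s => exp (-(γ / 4) * s) * J s)
      (exp (-(γ / 4) * x) * (exp (γ * x) * h x - γ / 4 * J x)) x := fun x => by
    have h1 : HasDerivAt (fun s => exp (-(γ / 4) * s)) (exp (-(γ / 4) * x) * -(γ / 4)) x := by
      simpa using ((hasDerivAt_id x).const_mul (-(γ / 4))).exp
    exact (h1.mul (hJd x)).congr_deriv (by ring)
  have hanti : AntitoneOn (fun s => exp (-(γ / 4) * s) * J s) (Ici S) := by
    refine antitoneOn_of_hasDerivWithinAt_nonpos (convex_Ici S)
      (fun x _ => (hDd x).continuousAt.continuousWithinAt)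
      (fun x _ => (hDd x).hasDerivWithinAt) fun x hx => ?_
    rw [interior_Ici] at hx
    exact mul_nonpos_of_nonneg_of_nonpos (exp_pos _).le (sub_nonpos.2 (hgr x (le_of_lt hx)))
  set D := exp (-(γ / 4) * S) * J S with hD
  have hJD : ∀ s, S ≤ s → J s ≤ D * exp (γ / 4 * s) := fun s hs => by
    have h2 : exp (-(γ / 4) * s) * J s ≤ D := hanti (mem_Ici.2 le_rfl) hs hs
    calc J s = exp (-(γ / 4) * s) * J s * exp (γ / 4 * s) := by
          rw [mul_right_comm, ← exp_add]; simp
      _ ≤ D * exp (γ / 4 * s) := by gcongr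
  have hfin : ∀ s, S ≤ s → exp (γ * s) * h s ≤ C * (K * D) ^ 2 * exp (-(γ / 2) * s) := by
    intro s hs
    have h3 : |w s| ≤ K * D * exp (-(3 * γ / 4) * s) := by
      calc |w s| ≤ K * (exp (-γ * s) * J s) := hw s
        _ ≤ K * (exp (-γ * s) * (D * exp (γ / 4 * s))) := by gcongr; exact hJD s hs
        _ = K * D * (exp (-γ * s) * exp (γ / 4 * s)) := by ring
        _ = _ := by rw [← exp_add]; ring_nf
    calc exp (γ * s) * h s ≤ exp (γ * s) * (C * |w s| ^ 2) := by
          rw [sq_abs]; gcongr; exact hhC s hs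
      _ ≤ exp (γ * s) * (C * (K * D * exp (-(3 * γ / 4) * s)) ^ 2) := by gcongr
      _ = C * (K * D) ^ 2 *
          (exp (γ * s) * (exp (-(3 * γ / 4) * s) * exp (-(3 * γ / 4) * s))) := by ring
      _ = _ := by rw [← exp_add, ← exp_add]; ring_nf
  rw [← integrableOn_univ, ← Iic_union_Ioi (a := S)]
  refine (hi S).union ?_
  refine Integrable.mono' ((exp_neg_integrableOn_Ioi S (half_pos hγ)).const_mul (C * (K * D) ^ 2))
    hcf.aestronglyMeasurable ?_
  filter_upwards [ae_restrict_mem measurableSet_Ioi] with s hs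
  rw [Real.norm_of_nonneg (mul_nonneg (exp_pos _).le (h0 s))]
  exact hfin s (le_of_lt hs)

lemma tendsto_integral_Iic_atTop {f : ℝ → ℝ} (hf : Integrable f) :
    Tendsto (fun s => ∫ t in Iic s, f t) atTop (𝓝 (∫ t, f t)) :=
  (aecover_Iic tendsto_id).integral_tendsto_of_countably_generated hf

/-- An integral weighted by a faster exponential is negligible. -/
lemma tendsto_exp_mul_integral_Iic_zero {γ δ : ℝ} {h : ℝ → ℝ} (hγδ : γ < δ)
    (hi : Integrable fun t => exp (γ * t) * h t) :
    Tendsto (fun s => exp (-(δ - γ) * s) * ∫ t in Iic s, exp (δ * t) * h t) atTop (𝓝 0) := by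
  have heq : (fun s => exp (-(δ - γ) * s) * ∫ t in Iic s, exp (δ * t) * h t) = fun s =>
      ∫ t, (Iic s).indicator (fun t => exp (-(δ - γ) * (s - t)) * (exp (γ * t) * h t)) t := by
    funext s
    rw [integral_indicator measurableSet_Iic, ← integral_const_mul]
    congr 1
    funext t
    rw [← mul_assoc, ← mul_assoc, ← exp_add, ← exp_add]
    ring_nf
  rw [heq, ← integral_zero ℝ ℝ]
  refine tendsto_integral_filter_of_dominated_convergence
    (fun t => ‖exp (γ * t) * h t‖) ?_ ?_ hi.norm ?_
  · refine Eventually.of_forall fun s => AEStronglyMeasurable.indicator ?_ measurableSet_Iic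
    exact (by fun_prop : Continuous fun t => exp (-(δ - γ) * (s - t))).aestronglyMeasurable.mul
      hi.aestronglyMeasurable
  · refine Eventually.of_forall fun s => Eventually.of_forall fun t => ?_
    rw [Set.indicator_apply]
    split_ifs with hts
    · rw [norm_mul, Real.norm_of_nonneg (exp_pos _).le]
      refine mul_le_of_le_one_left (norm_nonneg _) (exp_le_one_iff.2 ?_)
      have : 0 ≤ s - t := sub_nonneg.2 hts
      nlinarith
    · simpa only [norm_zero] using norm_nonneg _
  · refine Eventually.of_forall fun t => ?_
    have h1 : Tendsto (fun s : ℝ => exp (-(δ - γ) * (s - t)) * (exp (γ * t) * h t)) atTop (𝓝 0) := by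
      have h2 : Tendsto (fun s : ℝ => exp (-(δ - γ) * (s - t))) atTop (𝓝 0) :=
        tendsto_exp_atBot.comp
          ((tendsto_atTop_add_const_right atTop (-t) tendsto_id).const_mul_atTop_of_neg
            (by linarith))
      simpa using h2.mul_const (exp (γ * t) * h t)
    refine squeeze_zero_norm (fun s => ?_) (tendsto_zero_iff_norm_tendsto_zero.1 h1)
    exact norm_indicator_le_norm_self _ _

lemma rpow_sub_one_sub_mul_nonneg {a x : ℝ} (ha : 1 ≤ a) (hx : -1 < x) :
    0 ≤ (1 + x) ^ a - 1 - a * x := by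
  linarith [one_add_mul_self_le_rpow_one_add hx.le ha]

lemma rpow_sub_one_sub_mul_pos {a x : ℝ} (ha : 1 < a) (hx : -1 < x) (hx0 : x ≠ 0) :
    0 < (1 + x) ^ a - 1 - a * x := by
  linarith [one_add_mul_self_lt_rpow_one_add hx.le hx0 ha]

lemma rpow_sub_one_sub_mul_le {a x : ℝ} (ha : 1 ≤ a) (hx : -1 < x) :
    (1 + x) ^ a - 1 - a * x ≤ a * (((1 + x) ^ (a - 1) - 1) * x) := by
  have hp : 0 < 1 + x := by linarith
  have h1 : -1 ≤ -x / (1 + x) := by rw [le_div_iff₀ hp]; linarith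
  have h2 := one_add_mul_self_le_rpow_one_add h1 ha
  have h3 : 1 + -x / (1 + x) = (1 + x)⁻¹ := by field_simp; ring
  rw [h3, inv_rpow hp.le] at h2
  have hpa : 0 < (1 + x) ^ a := rpow_pos_of_pos hp a
  have h4 := mul_le_mul_of_nonneg_right h2 hpa.le
  rw [inv_mul_cancel₀ hpa.ne'] at h4
  have h5 : (1 + a * (-x / (1 + x))) * (1 + x) ^ a
      = (1 + x) ^ a - a * x * (1 + x) ^ (a - 1) := by
    rw [rpow_sub_one hp.ne']; field_simp; ring
  linarith

lemma isBigO_rpow_sub_one_sub_mul {a : ℝ} (ha : 1 ≤ a) {w : ℝ → ℝ} (hw1 : ∀ s, -1 < w s)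
    (hw0 : Tendsto w atTop (𝓝 0)) :
    (fun s => (1 + w s) ^ a - 1 - a * w s) =O[atTop] fun s => w s ^ 2 := by
  have hd : HasDerivAt (fun x : ℝ => (1 + x) ^ (a - 1)) (a - 1) 0 := by
    simpa using ((hasDerivAt_id (0 : ℝ)).const_add 1).rpow_const (p := a - 1) (by simp)
  have h1 : (fun s => (1 + w s) ^ (a - 1) - 1) =O[atTop] w := by
    simpa [Function.comp_def] using hd.isBigO_sub.comp_tendsto hw0
  have h2 := ((h1.mul (Asymptotics.isBigO_refl w atTop)).const_mul_left a)
  refine Asymptotics.IsBigO.trans (Asymptotics.IsBigO.of_bound 1 (Eventually.of_forall fun s => ?_))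
    (by simpa [sq] using h2)
  have h3 := rpow_sub_one_sub_mul_nonneg ha (hw1 s)
  rw [Real.norm_of_nonneg h3, one_mul]
  exact (rpow_sub_one_sub_mul_le ha (hw1 s)).trans (le_abs_self _)

lemma sub_two_sub_mul_pos {n : ℕ} {m : ℝ} (hn : 3 ≤ n) (hm1 : m < ((n : ℝ) - 2) / n) :
    0 < (n : ℝ) - 2 - n * m := by
  have hn' : (0 : ℝ) < n := by positivity
  rw [lt_div_iff₀ hn'] at hm1
  linarith

lemma lt_one_of_lt_sub_two_div {n : ℕ} {m : ℝ} (hn : 3 ≤ n) (hm1 : m < ((n : ℝ) - 2) / n) :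
    m < 1 := by
  have hn' : (0 : ℝ) < n := by positivity
  refine hm1.trans ?_
  rw [div_lt_one hn']
  linarith

lemma sqrt_lt_A0 {n : ℕ} {m β : ℝ} (hN : 0 < (n : ℝ) - 2 - n * m) (hβ : beta2 n m < β) :
    √(8 * ((n : ℝ) - 2 - n * m) * (1 - m)) < A0 n m β := by
  have h1 : √(8 * ((n : ℝ) - 2 - n * m) * (1 - m)) =
      2 * ((n : ℝ) - 2 - n * m) * √(2 * (1 - m) / ((n : ℝ) - 2 - n * m)) := by
    rw [← Real.sqrt_sq (by positivity : 0 ≤ 2 * ((n : ℝ) - 2 - n * m)),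
      ← Real.sqrt_mul (by positivity)]
    congr 1
    field_simp
    ring
  have h2 := mul_lt_mul_of_pos_left hβ (by positivity : 0 < 2 * ((n : ℝ) - 2 - n * m))
  have h3 : 2 * ((n : ℝ) - 2 - n * m) * beta2 n m =
      2 * ((n : ℝ) - 2 - n * m) * √(2 * (1 - m) / ((n : ℝ) - 2 - n * m)) +
        (((n : ℝ) + 2) * m - ((n : ℝ) - 2)) := by
    unfold beta2
    field_simp
  rw [h1, A0]
  linarith

lemma gamma_facts {n : ℕ} {m β : ℝ} (hN : 0 < (n : ℝ) - 2 - n * m) (hm : m < 1)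
    (hβ : beta2 n m < β) :
    0 < gamma1 n m β ∧ gamma1 n m β < gamma2 n m β ∧
      gamma1 n m β + gamma2 n m β = A0 n m β / (1 - m) ∧
      gamma1 n m β * gamma2 n m β = 2 * ((n : ℝ) - 2 - n * m) / (1 - m) := by
  have hm' : 0 < 1 - m := by linarith
  have hA := sqrt_lt_A0 hN hβ
  have hA0 : 0 < A0 n m β := (Real.sqrt_nonneg _).trans_lt hA
  have hP : 0 < 8 * ((n : ℝ) - 2 - n * m) * (1 - m) := by positivity
  have hdisc : 0 < A0 n m β ^ 2 - 8 * ((n : ℝ) - 2 - n * m) * (1 - m) :=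
    sub_pos.2 ((Real.sqrt_lt' hA0).1 hA)
  have hR := Real.sqrt_pos.2 hdisc
  have hRA : √(A0 n m β ^ 2 - 8 * ((n : ℝ) - 2 - n * m) * (1 - m)) < A0 n m β :=
    (Real.sqrt_lt' hA0).2 (by linarith)
  have hsq := Real.sq_sqrt hdisc.le
  unfold gamma1 gamma2
  refine ⟨div_pos (sub_pos.2 hRA) (by positivity), ?_, ?_, ?_⟩
  · gcongr
    linarith
  · field_simp
    ring
  · rw [div_mul_div_comm, div_eq_div_iff (by positivity) hm'.ne']
    linear_combination (-(1 - m)) * hsq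

lemma hasDerivAt_Phi {m : ℝ} (hm : 0 < m) {w w' : ℝ → ℝ} (hw1 : ∀ s, -1 < w s)
    (hw : ∀ s, HasDerivAt w (w' s) s) (s : ℝ) :
    HasDerivAt (Phi m w) (((1 + w s) ^ ((1 - m) / m) - 1) * w' s / m) s := by
  have hp : 0 < 1 + w s := by linarith [hw1 s]
  have h1 := ((((hw s).const_add 1).rpow_const (p := 1 / m) (Or.inl hp.ne')).sub_const 1).sub
    ((hw s).div_const m)
  refine h1.congr_deriv ?_
  rw [show 1 / m - 1 = (1 - m) / m by field_simp]
  ring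

/-- The perturbation equation, with its nonlinearity collected in terms of `Phi`. -/
lemma ode_Phi_form {n : ℕ} {m β x x' x'' : ℝ} (hm0 : m ≠ 0) (hm1 : 1 - m ≠ 0)
    (hode : x'' +
        (((n : ℝ) - 2 - ((n : ℝ) + 2) * m) / (1 - m) +
          β * Cstar n m / m * (1 + x) ^ ((1 - m) / m)) * x' +
        2 * m * ((n : ℝ) - 2 - n * m) / (1 - m) ^ 2 *
          ((1 + x) ^ (1 / m) - 1 - x) = 0) :
    x'' + A0 n m β / (1 - m) * x' + 2 * ((n : ℝ) - 2 - n * m) / (1 - m) * x =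
      -(Cstar n m * β * (((1 + x) ^ ((1 - m) / m) - 1) * x' / m) +
        Cstar n m / (1 - m) * ((1 + x) ^ (1 / m) - 1 - x / m)) := by
  generalize (1 + x) ^ ((1 - m) / m) = P at hode ⊢
  generalize (1 + x) ^ (1 / m) = Q at hode ⊢
  rw [← sub_eq_zero, ← hode]
  unfold A0 Cstar
  field_simp
  ring

/-- Abstract form of the limits at `+∞` for a solution written as a difference of two variation of
constants integrals from `-∞`. -/
lemma tendsto_of_mul_eq_integral_sub {γ δ p q : ℝ} {w h : ℝ → ℝ} (hγ : 0 < γ) (hγδ : γ < δ)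
    (hc : Continuous h) (h0 : ∀ s, 0 ≤ h s)
    (hi : ∀ ε, 0 < ε → ∀ s, IntegrableOn (fun t => exp (ε * t) * h t) (Iic s))
    (hw : ∀ s, (δ - γ) * w s = q * (exp (-δ * s) * ∫ t in Iic s, exp (δ * t) * h t) -
      p * (exp (-γ * s) * ∫ t in Iic s, exp (γ * t) * h t))
    (hw0 : Tendsto w atTop (𝓝 0)) (hhw : h =O[atTop] fun s => w s ^ 2) :
    Tendsto (fun s => exp (γ * s) * w s) atTop
        (𝓝 (-(p / (δ - γ)) * ∫ t, exp (γ * t) * h t)) ∧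
      (p = 0 → Integrable (fun t => exp (δ * t) * h t) ∧
        Tendsto (fun s => exp (δ * s) * w s) atTop
          (𝓝 (q / (δ - γ) * ∫ t, exp (δ * t) * h t))) := by
  have hd : 0 < δ - γ := sub_pos.2 hγδ
  have hδ : 0 < δ := hγ.trans hγδ
  have hw' : ∀ s, w s = q / (δ - γ) * (exp (-δ * s) * ∫ t in Iic s, exp (δ * t) * h t) -
      p / (δ - γ) * (exp (-γ * s) * ∫ t in Iic s, exp (γ * t) * h t) := fun s => by
    rw [div_mul_eq_mul_div, div_mul_eq_mul_div, ← sub_div, ← hw s, mul_div_cancel_left₀ _ hd.ne']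
  have hJ0 : ∀ ε s, 0 ≤ exp (-ε * s) * ∫ t in Iic s, exp (ε * t) * h t := fun ε s =>
    mul_nonneg (exp_pos _).le
      (setIntegral_nonneg measurableSet_Iic fun t _ => mul_nonneg (exp_pos _).le (h0 t))
  have hJle : ∀ s, exp (-δ * s) * ∫ t in Iic s, exp (δ * t) * h t ≤
      exp (-γ * s) * ∫ t in Iic s, exp (γ * t) * h t := fun s => by
    rw [← integral_const_mul, ← integral_const_mul]
    refine setIntegral_mono_on ((hi δ hδ s).const_mul _) ((hi γ hγ s).const_mul _)
      measurableSet_Iic fun t ht => ?_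
    rw [← mul_assoc, ← mul_assoc, ← exp_add, ← exp_add]
    refine mul_le_mul_of_nonneg_right (exp_le_exp.2 ?_) (h0 t)
    have : 0 ≤ s - t := sub_nonneg.2 ht
    nlinarith
  constructor
  · have hint : Integrable fun t => exp (γ * t) * h t := by
      refine integrable_exp_mul_of_abs_le (K := |q / (δ - γ)| + |p / (δ - γ)|) hγ (by positivity)
        hc h0 (hi γ hγ) (fun s => ?_) hw0 hhw
      rw [hw' s, add_mul]
      refine (abs_sub _ _).trans (add_le_add ?_ ?_)
      · rw [abs_mul, abs_of_nonneg (hJ0 δ s)]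
        exact mul_le_mul_of_nonneg_left (hJle s) (abs_nonneg _)
      · rw [abs_mul, abs_of_nonneg (hJ0 γ s)]
    have h1 := ((tendsto_exp_mul_integral_Iic_zero hγδ hint).const_mul (q / (δ - γ))).sub
      ((tendsto_integral_Iic_atTop hint).const_mul (p / (δ - γ)))
    rw [mul_zero, zero_sub, ← neg_mul] at h1
    refine h1.congr fun s => ?_
    have e1 : exp (-(δ - γ) * s) = exp (γ * s) * exp (-δ * s) := by
      rw [← exp_add]; ring_nf
    have e2 : exp (γ * s) * exp (-γ * s) = 1 := by rw [← exp_add]; simp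
    rw [hw' s, e1]
    linear_combination (-(p / (δ - γ)) * ∫ t in Iic s, exp (γ * t) * h t) * (-e2)
  · rintro rfl
    have hint : Integrable fun t => exp (δ * t) * h t := by
      refine integrable_exp_mul_of_abs_le (K := |q / (δ - γ)|) hδ (by positivity)
        hc h0 (hi δ hδ) (fun s => ?_) hw0 hhw
      rw [hw' s, zero_div, zero_mul, sub_zero, abs_mul, abs_of_nonneg (hJ0 δ s)]
    refine ⟨hint, ((tendsto_integral_Iic_atTop hint).const_mul (q / (δ - γ))).congr fun s => ?_⟩
    have e2 : exp (δ * s) * exp (-δ * s) = 1 := by rw [← exp_add]; simp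
    rw [hw' s]
    linear_combination (-(q / (δ - γ)) * ∫ t in Iic s, exp (δ * t) * h t) * e2

end

/-- Limit behavior of `w` at `+∞`: the precise second-order limits in terms of
`C₀ = C_*/(γ₂ − γ₁)`, `A_j` and the integrals `I_j`. -/
theorem w_limit_behavior (n : ℕ) (m β : ℝ) (hn : 3 ≤ n) (hm0 : 0 < m)
    (hm1 : m < ((n : ℝ) - 2) / n) (hβ : beta0 n m < β)
    (w : ℝ → ℝ) (hw1 : ∀ s, -1 < w s) (hw2 : ContDiff ℝ 2 w)
    (hode : ∀ s : ℝ,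
      deriv (deriv w) s +
        (((n : ℝ) - 2 - ((n : ℝ) + 2) * m) / (1 - m) +
          β * Cstar n m / m * (1 + w s) ^ ((1 - m) / m)) * deriv w s +
        2 * m * ((n : ℝ) - 2 - n * m) / (1 - m) ^ 2 *
          ((1 + w s) ^ (1 / m) - 1 - w s) = 0)
    (hbot : Tendsto w atBot (nhds (-1))) (htop : Tendsto w atTop (nhds 0)) :
    (Acoef1 n m β ≠ 0 →
      Tendsto (fun s => Real.exp (gamma1 n m β * s) * w s) atTop
        (nhds (-(Cstar n m / (gamma2 n m β - gamma1 n m β) * Acoef1 n m β *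
          ∫ t : ℝ, Real.exp (gamma1 n m β * t) * Phi m w t)))) ∧
    (Acoef1 n m β = 0 → Acoef2 n m β < 0 →
      Tendsto (fun s => Real.exp (gamma2 n m β * s) * w s) atTop
        (nhds (Cstar n m / (gamma2 n m β - gamma1 n m β) * Acoef2 n m β *
          ∫ t : ℝ, Real.exp (gamma2 n m β * t) * Phi m w t)) ∧
      Cstar n m / (gamma2 n m β - gamma1 n m β) * Acoef2 n m β *
          (∫ t : ℝ, Real.exp (gamma2 n m β * t) * Phi m w t) < 0) := by
  have hN := sub_two_sub_mul_pos hn hm1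
  have hm : m < 1 := lt_one_of_lt_sub_two_div hn hm1
  have hm' : 0 < 1 - m := sub_pos.2 hm
  obtain ⟨hg1, hg12, hsum, hprod⟩ := gamma_facts hN hm ((le_max_left _ _).trans_lt hβ)
  have hg2 := hg1.trans hg12
  have hd : 0 < gamma2 n m β - gamma1 n m β := sub_pos.2 hg12
  have hC : 0 < Cstar n m := by unfold Cstar; positivity
  have ha : 1 < 1 / m := (one_lt_div hm0).2 hm
  have hPhi : ∀ s, Phi m w s = (1 + w s) ^ (1 / m) - 1 - 1 / m * w s := fun s => by
    rw [Phi]; ring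
  have hw : ∀ s, HasDerivAt w (deriv w s) s := fun s =>
    (hw2.differentiable (by norm_num) s).hasDerivAt
  have hw' : ∀ s, HasDerivAt (deriv w) (deriv (deriv w) s) s := fun s =>
    ((ContDiff.iterate_deriv' 1 1 hw2).differentiable (by norm_num) s).hasDerivAt
  have hh := hasDerivAt_Phi hm0 hw1 hw
  have hcont : Continuous (Phi m w) := continuous_iff_continuousAt.2 fun x => (hh x).continuousAt
  have h0 : ∀ s, 0 ≤ Phi m w s := fun s => by
    rw [hPhi]; exact rpow_sub_one_sub_mul_nonneg ha.le (hw1 s)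
  have hPhiBot : Tendsto (Phi m w) atBot
      (𝓝 ((1 + -1) ^ (1 / m) - 1 - -1 / m)) :=
    (((hbot.const_add 1).rpow_const (Or.inr (by positivity))).sub_const 1).sub
      (hbot.div_const m)
  have hO : Phi m w =O[atTop] fun s => w s ^ 2 := by
    rw [funext hPhi]; exact isBigO_rpow_sub_one_sub_mul ha.le hw1 htop
  have hode' := fun s => ode_Phi_form hm0.ne' hm'.ne' (hode s)
  have hE1 := exp_mul_eq_integral_Iic (γ := gamma1 n m β) (δ := gamma2 n m β) hg1 hw hw' hh
    (fun s => by rw [hsum, hprod]; exact hode' s) hbot hPhiBot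
  have hE2 := exp_mul_eq_integral_Iic (γ := gamma2 n m β) (δ := gamma1 n m β) hg2 hw hw' hh
    (fun s => by rw [add_comm (gamma2 n m β), hsum, mul_comm (gamma2 n m β), hprod]; exact hode' s) hbot hPhiBot
  have hrep : ∀ s, (gamma2 n m β - gamma1 n m β) * w s =
      Cstar n m * Acoef2 n m β * (exp (-gamma2 n m β * s) *
        ∫ t in Iic s, exp (gamma2 n m β * t) * Phi m w t) -
      Cstar n m * Acoef1 n m β * (exp (-gamma1 n m β * s) *
        ∫ t in Iic s, exp (gamma1 n m β * t) * Phi m w t) := fun s => by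
    have e1 : exp (-gamma1 n m β * s) * exp (gamma1 n m β * s) = 1 := by rw [← exp_add]; simp
    have e2 : exp (-gamma2 n m β * s) * exp (gamma2 n m β * s) = 1 := by rw [← exp_add]; simp
    unfold Acoef1 Acoef2
    linear_combination exp (-gamma1 n m β * s) * hE1 s - exp (-gamma2 n m β * s) * hE2 s
      - (deriv w s + gamma2 n m β * w s + Cstar n m * β * Phi m w s) * e1
      + (deriv w s + gamma1 n m β * w s + Cstar n m * β * Phi m w s) * e2
  obtain ⟨hlim1, hlim2⟩ := tendsto_of_mul_eq_integral_sub hg1 hg12 hcont h0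
    (fun ε hε => integrableOn_Iic_exp_mul hε hcont hPhiBot) hrep htop hO
  refine ⟨fun _ => ?_, fun hA1 hA2 => ?_⟩
  · convert hlim1 using 2
    ring
  · obtain ⟨hint, hlim⟩ := hlim2 (by rw [hA1, mul_zero])
    refine ⟨?_, ?_⟩
    · convert hlim using 2
      ring
    · refine mul_neg_of_neg_of_pos (mul_neg_of_pos_of_neg (div_pos hC hd) hA2) ?_
      obtain ⟨s, hs⟩ := (hbot.eventually (gt_mem_nhds (by norm_num : (-1 : ℝ) < 0))).exists
      refine integral_pos_of_integrable_nonneg_nonzero (x := s) (by fun_prop) hint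
        (fun t => mul_nonneg (exp_pos _).le (h0 t)) (mul_pos (exp_pos _) ?_).ne'
      rw [hPhi]
      exact rpow_sub_one_sub_mul_pos ha (hw1 s) hs.ne
end

section
/- Suppose condition (C2) holds. Then for any λ_2 > λ_1 > 0 there exist constants r_2 > r_0 > r_1 > 0 such that f_{λ_1}(r_0) = f_{λ_2}(r_0), and (i) f_{λ_2}(r) > f_{λ_1}(r) for all 0 ≤ r < r_1, and (ii) f_{λ_2}(r) < f_{λ_1}(r) for all r > r_2. -/
open Real Filter MeasureTheory Set Topology

/-- Bernoulli's inequality in the form needed to see that the nonlinear remainder is positive. -/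
theorem rpow_remainder_pos {p x : ℝ} (hp : 1 < p) (hx : 0 < x) (hx1 : x ≠ 1) :
    0 < x ^ p - 1 - p * (x - 1) := by
  have h := one_add_mul_self_lt_rpow_one_add (s := x - 1) (by linarith) (sub_ne_zero.2 hx1) hp
  rw [add_sub_cancel] at h
  linarith

theorem rpow_remainder_nonneg {p x : ℝ} (hp : 1 < p) (hx : 0 < x) :
    0 ≤ x ^ p - 1 - p * (x - 1) := by
  rcases eq_or_ne x 1 with rfl | h
  · simp
  · exact (rpow_remainder_pos hp hx h).le

theorem eventually_rpow_remainder_le (p : ℝ) {ε : ℝ} (hε : 0 < ε) :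
    ∀ᶠ x in 𝓝 (1 : ℝ), x ^ p - 1 - p * (x - 1) ≤ ε * |x - 1| := by
  have h : HasDerivAt (fun x : ℝ => x ^ p) p 1 := by
    simpa using Real.hasDerivAt_rpow_const (x := 1) (p := p) (Or.inl one_ne_zero)
  filter_upwards [h.isLittleO.def hε] with x hx
  simp only [Real.one_rpow, smul_eq_mul, Real.norm_eq_abs] at hx
  have := (le_abs_self _).trans hx
  linarith [mul_comm p (x - 1)]

section PhasePlane

variable {v v₁ v₂ g₁ : ℝ → ℝ} {p b A B γ δ : ℝ}

/-- The quantity `e^{γs} (v' + δ (v - 1) + B Φ(v))` is strictly positive. -/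
theorem monotone_and_pos_of_profile_ode
    (hp : 1 < p) (hAB : A < B * γ) (hγ : 0 < γ)
    (hsum : γ + δ = b + B * p) (hprod : γ * δ = A * (p - 1))
    (hpos : ∀ s, 0 < v s) (hv : ∀ s, HasDerivAt v (v₁ s) s)
    (hv₁ : ∀ s, HasDerivAt v₁ (v₂ s) s)
    (hg : ∀ s, HasDerivAt (fun t => v t ^ p) (g₁ s) s)
    (hode : ∀ s, v₂ s + b * v₁ s + B * g₁ s + A * (v s ^ p - v s) = 0)
    (hv_bot : Tendsto v atBot (𝓝 0)) (hv₁_bot : Tendsto v₁ atBot (𝓝 0)) :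
    Monotone (fun s => exp (γ * s) *
        (v₁ s + δ * (v s - 1) + B * (v s ^ p - 1 - p * (v s - 1)))) ∧
      ∀ s, 0 < exp (γ * s) *
        (v₁ s + δ * (v s - 1) + B * (v s ^ p - 1 - p * (v s - 1))) := by
  set H : ℝ → ℝ := fun s => exp (γ * s) *
    (v₁ s + δ * (v s - 1) + B * (v s ^ p - 1 - p * (v s - 1)))
  have hH' : ∀ s, HasDerivAt H
      ((B * γ - A) * (exp (γ * s) * (v s ^ p - 1 - p * (v s - 1)))) s := by
    intro s
    have he : HasDerivAt (fun t => exp (γ * t)) (exp (γ * s) * γ) s := by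
      simpa using ((hasDerivAt_id s).const_mul γ).exp
    have h := he.mul (((hv₁ s).add (((hv s).sub_const 1).const_mul δ)).add
      ((((hg s).sub_const 1).sub (((hv s).sub_const 1).const_mul p)).const_mul B))
    refine h.congr_deriv ?_
    simp only [Pi.add_apply, Pi.sub_apply]
    linear_combination exp (γ * s) * hode s + exp (γ * s) * v₁ s * hsum
      + exp (γ * s) * (v s - 1) * hprod
  have hmono : Monotone H := by
    refine monotone_of_deriv_nonneg (fun s => (hH' s).differentiableAt) fun s => ?_
    rw [(hH' s).deriv]
    have := rpow_remainder_nonneg hp (hpos s)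
    have := sub_pos.2 hAB
    positivity
  have hbot : Tendsto H atBot (𝓝 0) := by
    have h1 : Tendsto (fun s => exp (γ * s)) atBot (𝓝 0) :=
      tendsto_exp_atBot.comp (tendsto_id.const_mul_atBot hγ)
    have h2 : Tendsto (fun s => v s ^ p) atBot (𝓝 (0 ^ p)) :=
      hv_bot.rpow_const (Or.inr (by linarith))
    have h3 := h1.mul ((hv₁_bot.add ((hv_bot.sub_const 1).const_mul δ)).add
      (((h2.sub_const 1).sub ((hv_bot.sub_const 1).const_mul p)).const_mul B))
    simpa only [zero_mul] using h3
  have hnonneg : ∀ s, 0 ≤ H s := fun s => hmono.le_of_tendsto hbot s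
  refine ⟨hmono, fun s => (hnonneg s).lt_of_ne fun hs => ?_⟩
  obtain ⟨t, hts, ht⟩ :=
    ((eventually_lt_atBot s).and (hv_bot.eventually (gt_mem_nhds one_pos))).exists
  have hzero : H =ᶠ[𝓝 t] fun _ => 0 := by
    filter_upwards [gt_mem_nhds hts] with x hx
    exact le_antisymm ((hmono hx.le).trans hs.ge) (hnonneg x)
  have h0 := (hH' t).unique ((hasDerivAt_const t (0 : ℝ)).congr_of_eventuallyEq hzero)
  have h1 := rpow_remainder_pos hp (hpos t) ht.ne
  have h2 := sub_pos.2 hAB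
  have : 0 < (B * γ - A) * (exp (γ * t) * (v t ^ p - 1 - p * (v t - 1))) := by positivity
  linarith

/-- The orbit must reach the equilibrium value `1`. -/
theorem exists_one_le_of_profile_ode
    (hB : 0 < B) (hγδ : γ < δ)
    (hv : ∀ s, HasDerivAt v (v₁ s) s)
    (hmono : Monotone (fun s => exp (γ * s) *
      (v₁ s + δ * (v s - 1) + B * (v s ^ p - 1 - p * (v s - 1)))))
    (hHpos : ∀ s, 0 < exp (γ * s) *
      (v₁ s + δ * (v s - 1) + B * (v s ^ p - 1 - p * (v s - 1))))
    (hv_top : Tendsto v atTop (𝓝 1)) : ∃ s, 1 ≤ v s := by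
  by_contra! hlt
  have hε : 0 < (δ - γ) / B := div_pos (sub_pos.2 hγδ) hB
  obtain ⟨S₀, hS₀⟩ := eventually_atTop.1 (hv_top.eventually (eventually_rpow_remainder_le p hε))
  set S := max S₀ 0
  set c := exp (γ * 0) * (v₁ 0 + δ * (v 0 - 1) + B * (v 0 ^ p - 1 - p * (v 0 - 1)))
  have hcpos : 0 < c := hHpos 0
  have hz : ∀ s, HasDerivAt (fun t => exp (γ * t) * (1 - v t) + c * t)
      (exp (γ * s) * (γ * (1 - v s) - v₁ s) + c) s := by
    intro s
    have he : HasDerivAt (fun t => exp (γ * t)) (exp (γ * s) * γ) s := by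
      simpa using ((hasDerivAt_id s).const_mul γ).exp
    refine ((he.mul ((hv s).const_sub 1)).add ((hasDerivAt_id s).const_mul c)).congr_deriv ?_
    ring
  have hanti : AntitoneOn (fun t => exp (γ * t) * (1 - v t) + c * t) (Ici S) := by
    refine antitoneOn_of_deriv_nonpos (convex_Ici S)
      (fun s _ => (hz s).continuousAt.continuousWithinAt)
      (fun s _ => (hz s).differentiableAt.differentiableWithinAt) fun s hs => ?_
    rw [interior_Ici, mem_Ioi] at hs
    rw [(hz s).deriv]
    have h1 : c ≤ _ := hmono ((le_max_right S₀ 0).trans hs.le)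
    have h2 := hS₀ s ((le_max_left S₀ 0).trans hs.le)
    rw [abs_of_neg (sub_neg.2 (hlt s))] at h2
    have h3 : B * (v s ^ p - 1 - p * (v s - 1)) ≤ (δ - γ) * (1 - v s) := by
      have := mul_le_mul_of_nonneg_left h2 hB.le
      calc _ ≤ _ := this
        _ = _ := by field_simp; ring
    have h4 := mul_le_mul_of_nonneg_left h3 (exp_pos (γ * s)).le
    simp only at h1
    nlinarith
  set Z := exp (γ * S) * (1 - v S) + c * S
  obtain ⟨s, hs, hsZ⟩ := ((eventually_ge_atTop S).and
    (eventually_gt_atTop (Z / c))).exists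
  have h1 : exp (γ * s) * (1 - v s) + c * s ≤ Z := hanti self_mem_Ici hs hs
  have h2 : Z < c * s := by rwa [div_lt_iff₀' hcpos] at hsZ
  have h3 := mul_pos (exp_pos (γ * s)) (sub_pos.2 (hlt s))
  linarith

/-- An orbit from `0` to `1` overshoots `1` and is eventually strictly decreasing. -/
theorem exists_strictAntiOn_of_profile_ode
    (hp : 1 < p) (hA : 0 < A) (hB : 0 < B) (hAB : A < B * γ) (hγ : 0 < γ) (hγδ : γ < δ)
    (hsum : γ + δ = b + B * p) (hprod : γ * δ = A * (p - 1))
    (hpos : ∀ s, 0 < v s) (hv : ∀ s, HasDerivAt v (v₁ s) s)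
    (hv₁ : ∀ s, HasDerivAt v₁ (v₂ s) s)
    (hg : ∀ s, HasDerivAt (fun t => v t ^ p) (g₁ s) s)
    (hode : ∀ s, v₂ s + b * v₁ s + B * g₁ s + A * (v s ^ p - v s) = 0)
    (hv_bot : Tendsto v atBot (𝓝 0)) (hv₁_bot : Tendsto v₁ atBot (𝓝 0))
    (hv_top : Tendsto v atTop (𝓝 1)) : ∃ S, StrictAntiOn v (Ici S) := by
  obtain ⟨hmono, hHpos⟩ := monotone_and_pos_of_profile_ode hp hAB hγ hsum hprod hpos hv hv₁ hg
    hode hv_bot hv₁_bot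
  obtain ⟨s₀, hs₀⟩ := exists_one_le_of_profile_ode hB hγδ hv hmono hHpos hv_top
  have hcross : ∀ s, v s = 1 → 0 < v₁ s := by
    intro s hs
    have h := hHpos s
    rw [hs] at h
    simpa using pos_of_mul_pos_right h (exp_pos _).le
  have hge : ∀ s, s₀ ≤ s → 1 ≤ v s := fun s hs =>
    image_le_of_deriv_right_lt_deriv_boundary (f := fun _ => (1 : ℝ)) (f' := fun _ => 0)
      (a := s₀) (b := s) continuousOn_const (fun x _ => hasDerivWithinAt_const _ _ _) hs₀
      hv (fun x _ hx => hcross x hx.symm) (right_mem_Icc.2 hs)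
  have hcrit : ∀ s, s₀ ≤ s → v₁ s = 0 → v₂ s < 0 := by
    intro s hs h0
    have h1 : 1 < v s := (hge s hs).lt_of_ne fun h => (hcross s h.symm).ne' h0
    have h2 : v s < v s ^ p := by
      simpa using Real.rpow_lt_rpow_of_exponent_lt h1 hp
    have h3 : g₁ s = 0 := by
      have := ((hv s).rpow_const (p := p) (Or.inl (hpos s).ne')).unique (hg s)
      rw [h0] at this
      simpa using this.symm
    have h4 := hode s
    rw [h0, h3] at h4
    have := mul_pos hA (sub_pos.2 h2)
    linarith
  obtain ⟨s₁, hs₁, hneg⟩ : ∃ s, s₀ ≤ s ∧ v₁ s ≤ 0 := by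
    by_contra! h
    have hm : StrictMonoOn v (Ici s₀) := by
      refine strictMonoOn_of_deriv_pos (convex_Ici s₀)
        (fun s _ => (hv s).continuousAt.continuousWithinAt) fun s hs => ?_
      rw [interior_Ici, mem_Ioi] at hs
      rw [(hv s).deriv]
      exact h s hs.le
    have h1 : v s₀ < v (s₀ + 1) := hm self_mem_Ici (mem_Ici.2 (by linarith)) (by linarith)
    have h2 : v (s₀ + 1) ≤ 1 := by
      refine ge_of_tendsto hv_top ?_
      filter_upwards [eventually_ge_atTop (s₀ + 1)] with t ht
      exact hm.monotoneOn (mem_Ici.2 (by linarith)) (mem_Ici.2 (by linarith)) ht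
    linarith
  have hle : ∀ s, s₁ ≤ s → v₁ s ≤ 0 := fun s hs =>
    image_le_of_deriv_right_lt_deriv_boundary (f := v₁) (f' := v₂) (B := fun _ => 0)
      (B' := fun _ => 0) (a := s₁) (b := s)
      (fun x _ => (hv₁ x).continuousAt.continuousWithinAt)
      (fun x _ => (hv₁ x).hasDerivWithinAt) hneg (fun x => hasDerivAt_const _ _)
      (fun x hx h0 => hcrit x (hs₁.trans hx.1) h0) (right_mem_Icc.2 hs)
  refine ⟨s₁, strictAntiOn_of_deriv_neg (convex_Ici s₁)
    (fun s _ => (hv s).continuousAt.continuousWithinAt) fun s hs => ?_⟩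
  rw [interior_Ici, mem_Ioi] at hs
  rw [(hv s).deriv]
  refine (hle s hs.le).lt_of_ne fun h0 => ?_
  have hmax : IsLocalMax v₁ s := by
    filter_upwards [lt_mem_nhds hs] with x hx
    rw [h0]
    exact hle x (le_of_lt hx)
  exact (hcrit s (hs₁.trans hs.le) h0).ne (hmax.hasDerivAt_eq_zero (hv₁ s))

end PhasePlane

/-- The decay rates of the linearization at infinity; the slower one exceeds `1 / (β (1 - m))`. -/
theorem exists_decay_rates {m β N : ℝ} (hm0 : 0 < m) (hm1 : m < 1) (hN : 0 < N) (hβ : 0 < β)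
    (hβN : β * N < 1) (hNm : N < 2 * (1 - m))
    (hβ2 : √(2 * (1 - m) / N) + (2 * m - N) / (2 * N) < β) :
    ∃ γ δ : ℝ, 0 < γ ∧ γ < δ ∧ γ + δ = (N - 2 * m + 2 * β * N) / (1 - m) ∧
      γ * δ = 2 * N / (1 - m) ∧ 1 < β * (1 - m) * γ := by
  have ha : 0 < 1 - m := by linarith
  obtain ⟨u, hu0, hu⟩ : ∃ u : ℝ, 0 < u ∧ u ^ 2 = 2 * (1 - m) :=
    ⟨√(2 * (1 - m)), by positivity, Real.sq_sqrt (by positivity)⟩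
  obtain ⟨w, hw0, hw⟩ : ∃ w : ℝ, 0 < w ∧ w ^ 2 = N :=
    ⟨√N, by positivity, Real.sq_sqrt hN.le⟩
  set a₀ := N - 2 * m + 2 * β * N
  have hroot : √(2 * (1 - m) / N) = u / w := by
    rw [← hu, ← hw, ← div_pow, Real.sqrt_sq (by positivity)]
  have huw : 2 * (u * w) < a₀ := by
    rw [hroot] at hβ2
    have h := mul_lt_mul_of_pos_right hβ2 (show 0 < 2 * N by positivity)
    have h' : (u / w + (2 * m - N) / (2 * N)) * (2 * N) = 2 * (u * w) + (2 * m - N) := by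
      rw [← hw]; field_simp
    rw [h'] at h
    linarith
  have ha₀pos : 0 < a₀ := lt_trans (by positivity) huw
  have hDpos : 0 < a₀ ^ 2 - 8 * N * (1 - m) := by
    have h : (2 * (u * w)) ^ 2 < a₀ ^ 2 := pow_lt_pow_left₀ huw (by positivity) two_ne_zero
    have h' : (2 * (u * w)) ^ 2 = 8 * N * (1 - m) := by
      rw [mul_pow, mul_pow, hu, hw]; ring
    linarith
  have hβa : 2 < β * a₀ := by
    by_contra! hle
    set x := β * N
    have hx0 : 0 < x := by positivity
    have hxu : x * u < w := by
      have h1 : x * a₀ ≤ 2 * w ^ 2 := by rw [hw]; nlinarith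
      have h2 : x * (2 * (u * w)) < 2 * w ^ 2 := (mul_lt_mul_of_pos_left huw hx0).trans_le h1
      nlinarith
    have hwu : w < u := lt_of_pow_lt_pow_left₀ 2 hu0.le (by rw [hu, hw]; exact hNm)
    have h3 : 2 * (1 - x) < (u - w) ^ 2 := by nlinarith
    have h4 : (u - w) ^ 2 < (u * (1 - x)) ^ 2 :=
      pow_lt_pow_left₀ (by nlinarith) (by linarith) two_ne_zero
    have h5 : (u * (1 - x)) ^ 2 = 2 * (1 - m) * (1 - x) ^ 2 := by rw [mul_pow, hu]
    have h6 : 0 < 1 - x := by linarith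
    have h7 : (1 - m) * (1 - x) < 1 := by nlinarith
    nlinarith
  obtain ⟨d, hd0, hd⟩ : ∃ d : ℝ, 0 < d ∧ d ^ 2 = a₀ ^ 2 - 8 * N * (1 - m) :=
    ⟨√(a₀ ^ 2 - 8 * N * (1 - m)), Real.sqrt_pos.2 hDpos, Real.sq_sqrt hDpos.le⟩
  have hkey : β * d < β * a₀ - 2 := by
    refine lt_of_pow_lt_pow_left₀ 2 (by linarith) ?_
    rw [mul_pow, hd]
    have : 0 < (1 - N * β) * (1 + 2 * m * β) :=
      mul_pos (by linarith [mul_comm N β]) (by positivity)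
    nlinarith
  have hda : d < a₀ := by
    refine lt_of_mul_lt_mul_left (a := β) ?_ hβ.le
    linarith
  refine ⟨(a₀ - d) / (2 * (1 - m)), (a₀ + d) / (2 * (1 - m)), div_pos (by linarith) (by linarith),
    ?_, ?_, ?_, ?_⟩
  · gcongr
    linarith
  · field_simp
    ring
  · field_simp
    linear_combination -hd
  · have : β * (1 - m) * ((a₀ - d) / (2 * (1 - m))) = (β * a₀ - β * d) / 2 := by
      field_simp
    rw [this]
    linarith

/-- The profile in logarithmic variables, normalized by the singular solution, and raised to the
power `m`. -/
noncomputable def logProfile (n : ℕ) (m : ℝ) (f : ℝ → ℝ) (s : ℝ) : ℝ :=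
  exp (2 * m / (1 - m) * s) * f (exp s) ^ m / Cstar n m ^ (m / (1 - m))

theorem Cstar_pos {n : ℕ} {m : ℝ} (hm0 : 0 < m) (hm1 : m < 1) (hN : 0 < (n : ℝ) - 2 - n * m) :
    0 < Cstar n m := by
  have : 0 < 1 - m := by linarith
  unfold Cstar
  positivity

section LogProfile

variable {n : ℕ} {m β α lam : ℝ} {f : ℝ → ℝ}

theorem logProfile_eq_rpow (hm1 : m < 1) (hC : 0 < Cstar n m) {s : ℝ} (hf : 0 < f (exp s)) :
    logProfile n m f s = (exp s ^ 2 * f (exp s) ^ (1 - m) / Cstar n m) ^ (m / (1 - m)) := by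
  have ha : 1 - m ≠ 0 := by linarith
  rw [logProfile, Real.div_rpow (by positivity) hC.le, Real.mul_rpow (by positivity)
    (by positivity), ← Real.rpow_mul hf.le, ← Real.exp_nat_mul, ← Real.exp_mul]
  congr 3
  · push_cast
    ring
  · field_simp

theorem logProfile_rpow_inv (hm0 : 0 < m) (hm1 : m < 1) (hC : 0 < Cstar n m) {s : ℝ}
    (hf : 0 < f (exp s)) :
    logProfile n m f s ^ (1 / m) = exp (2 * m / (1 - m) * s) * exp s ^ 2 * f (exp s) /
      (Cstar n m * Cstar n m ^ (m / (1 - m))) := by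
  have ha : 1 - m ≠ 0 := by linarith
  rw [logProfile, Real.div_rpow (by positivity) (by positivity), Real.mul_rpow (by positivity)
    (by positivity), ← Real.rpow_mul hf.le, ← Real.exp_mul, ← Real.rpow_mul hC.le,
    ← Real.exp_nat_mul, ← Real.exp_add]
  congr 2
  · congr 1
    push_cast
    field_simp
    ring
  · rw [mul_one_div_cancel hm0.ne', Real.rpow_one]
  · rw [← Real.rpow_one_add' hC.le]
    · congr 1
      field_simp
      ring
    · have : 0 < m / (1 - m) := div_pos hm0 (by linarith)
      linarith

namespace IsProfile

theorem contDiffAt (hf : IsProfile n m β α lam f) {r : ℝ} (hr : 0 < r) : ContDiffAt ℝ 2 f r :=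
  hf.smooth.contDiffAt (Ici_mem_nhds hr)

theorem hasDerivAt (hf : IsProfile n m β α lam f) {r : ℝ} (hr : 0 < r) :
    HasDerivAt f (deriv f r) r :=
  ((hf.contDiffAt hr).differentiableAt two_ne_zero).hasDerivAt

theorem hasDerivAt_rpow (hf : IsProfile n m β α lam f) {r : ℝ} (hr : 0 < r) :
    HasDerivAt (fun x => f x ^ m) (deriv (fun x => f x ^ m) r) r :=
  (((hf.contDiffAt hr).rpow_const_of_ne (hf.pos r hr.le).ne').differentiableAt
    two_ne_zero).hasDerivAt

theorem hasDerivAt_deriv_rpow (hf : IsProfile n m β α lam f) {r : ℝ} (hr : 0 < r) :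
    HasDerivAt (deriv fun x => f x ^ m) (deriv (deriv fun x => f x ^ m) r) r := by
  have h : ContDiffAt ℝ 2 (fun x => f x ^ m) r :=
    (hf.contDiffAt hr).rpow_const_of_ne (hf.pos r hr.le).ne'
  exact ((h.derivWithin (m := 1) (by norm_num)).differentiableAt one_ne_zero).hasDerivAt

theorem tendsto_deriv_rpow (hf : IsProfile n m β α lam f) :
    ∃ l, Tendsto (deriv fun x => f x ^ m) (𝓝[>] 0) (𝓝 l) := by
  have h : ContDiffOn ℝ 2 (fun x => f x ^ m) (Ici 0) :=
    hf.smooth.rpow_const_of_ne fun x hx => (hf.pos x hx).ne'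
  have hc := h.continuousOn_derivWithin (uniqueDiffOn_Ici 0) (by norm_num) 0 self_mem_Ici
  refine ⟨_, (hc.tendsto.mono_left (nhdsWithin_mono _ Ioi_subset_Ici_self)).congr' ?_⟩
  filter_upwards [self_mem_nhdsWithin] with x hx
  exact derivWithin_of_mem_nhds (Ici_mem_nhds hx)

theorem hasDerivAt_logProfile (hf : IsProfile n m β α lam f) (s : ℝ) :
    HasDerivAt (logProfile n m f)
      ((2 * m / (1 - m) * (exp (2 * m / (1 - m) * s) * f (exp s) ^ m) +
        exp (2 * m / (1 - m) * s) * (exp s * deriv (fun x => f x ^ m) (exp s))) /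
          Cstar n m ^ (m / (1 - m))) s := by
  have he : HasDerivAt (fun t => exp (2 * m / (1 - m) * t))
      (exp (2 * m / (1 - m) * s) * (2 * m / (1 - m))) s := by
    simpa using ((hasDerivAt_id s).const_mul (2 * m / (1 - m))).exp
  have h := (hf.hasDerivAt_rpow (exp_pos s)).comp s (Real.hasDerivAt_exp s)
  refine ((he.mul h).div_const (Cstar n m ^ (m / (1 - m)))).congr_deriv ?_
  simp only [Function.comp_apply]
  ring

theorem exists_strictAntiOn_logProfile (hf : IsProfile n m β α lam f)
    (hm0 : 0 < m) (hm1 : m < 1) (hN : 0 < (n : ℝ) - 2 - n * m) (hβ : 0 < β)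
    (hα : α = (2 * β + 1) / (1 - m)) (hβN : β * ((n : ℝ) - 2 - n * m) < 1)
    (hNm : (n : ℝ) - 2 - n * m < 2 * (1 - m)) (hβ2 : beta2 n m < β) :
    ∃ S, StrictAntiOn (logProfile n m f) (Ici S) := by
  have ha : 0 < 1 - m := by linarith
  have hC : 0 < Cstar n m := Cstar_pos hm0 hm1 hN
  obtain ⟨γ, δ, hγ, hγδ, hsum, hprod, hβγ⟩ := exists_decay_rates hm0 hm1 hN hβ hβN hNm
    (by
      refine lt_of_eq_of_lt ?_ hβ2
      rw [beta2]
      congr 2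
      ring)
  have hfpos : ∀ s, 0 < f (exp s) := fun s => hf.pos _ (exp_pos s).le
  set k := 2 * m / (1 - m) with hk
  have hkpos : 0 < k := by positivity
  set q := Cstar n m ^ (m / (1 - m)) with hq
  have hqpos : 0 < q := by positivity
  have hCa : Cstar n m = k * ((n : ℝ) - 2 - n * m) := by rw [Cstar, hk]; ring
  have hexp : ∀ s, HasDerivAt (fun t => exp (k * t)) (exp (k * s) * k) s := fun s => by
    simpa using ((hasDerivAt_id s).const_mul k).exp
  have hg : ∀ s, HasDerivAt (fun t => logProfile n m f t ^ (1 / m))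
      (((k + 2) * (exp (k * s) * exp s ^ 2 * f (exp s)) +
        exp (k * s) * exp s ^ 3 * deriv f (exp s)) / (Cstar n m * q)) s := by
    intro s
    simp_rw [fun t => logProfile_rpow_inv hm0 hm1 hC (hfpos t)]
    have h := (hf.hasDerivAt (exp_pos s)).comp s (Real.hasDerivAt_exp s)
    refine ((((hexp s).mul ((Real.hasDerivAt_exp s).pow 2)).mul h).div_const
      (Cstar n m * q)).congr_deriv ?_
    simp only [Function.comp_apply, Pi.mul_apply, Pi.pow_apply]
    push_cast
    ring
  have hv₁ : ∀ s, HasDerivAt (fun s => (k * (exp (k * s) * f (exp s) ^ m) +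
      exp (k * s) * (exp s * deriv (fun x => f x ^ m) (exp s))) / q)
      ((k ^ 2 * (exp (k * s) * f (exp s) ^ m) +
        (2 * k + 1) * (exp (k * s) * (exp s * deriv (fun x => f x ^ m) (exp s))) +
        exp (k * s) * (exp s ^ 2 * deriv (deriv fun x => f x ^ m) (exp s))) / q) s := by
    intro s
    have h := (hf.hasDerivAt_rpow (exp_pos s)).comp s (Real.hasDerivAt_exp s)
    have h' := (hf.hasDerivAt_deriv_rpow (exp_pos s)).comp s (Real.hasDerivAt_exp s)
    refine (((((hexp s).mul h).const_mul k).add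
      ((hexp s).mul ((Real.hasDerivAt_exp s).mul h'))).div_const q).congr_deriv ?_
    simp only [Function.comp_apply, Pi.mul_apply]
    ring
  have hode : ∀ s, ((k ^ 2 * (exp (k * s) * f (exp s) ^ m) +
        (2 * k + 1) * (exp (k * s) * (exp s * deriv (fun x => f x ^ m) (exp s))) +
        exp (k * s) * (exp s ^ 2 * deriv (deriv fun x => f x ^ m) (exp s))) / q) +
      (n - 2 - 2 * k) * ((k * (exp (k * s) * f (exp s) ^ m) +
        exp (k * s) * (exp s * deriv (fun x => f x ^ m) (exp s))) / q) +
      Cstar n m * β * (((k + 2) * (exp (k * s) * exp s ^ 2 * f (exp s)) +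
        exp (k * s) * exp s ^ 3 * deriv f (exp s)) / (Cstar n m * q)) +
      Cstar n m / (1 - m) * (logProfile n m f s ^ (1 / m) - logProfile n m f s) = 0 := by
    intro s
    have h := hf.ode _ (exp_pos s)
    rw [logProfile_rpow_inv hm0 hm1 hC (hfpos s), logProfile, ← hk, ← hq]
    have hr := exp_pos s
    generalize deriv (deriv fun x => f x ^ m) (exp s) = F₂ at *
    generalize deriv (fun x => f x ^ m) (exp s) = F₁ at *
    generalize deriv f (exp s) = f₁ at *
    generalize f (exp s) ^ m = F at *
    generalize f (exp s) = y at *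
    generalize exp (k * s) = E at *
    generalize exp s = r at *
    have hα' : α = β * (k + 2) + 1 / (1 - m) := by
      rw [hα, hk]; field_simp; ring
    have hC' : Cstar n m / (1 - m) = k * (n - 2 - k) := by
      rw [hCa, hk]; field_simp; ring
    have h2 : r ^ 2 * F₂ = -((n - 1) * (r * F₁)) - α * (r ^ 2 * y) - β * (r ^ 3 * f₁) := by
      have : ((n : ℝ) - 1) / r * r ^ 2 = (n - 1) * r := by field_simp
      linear_combination r ^ 2 * h - F₁ * this
    have h3 : Cstar n m / (1 - m) * (E * r ^ 2 * y / (Cstar n m * q) - E * F / q) =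
        1 / (1 - m) * (E * r ^ 2 * y / q) - k * (n - 2 - k) * (E * F / q) := by
      rw [← hC']
      field_simp
    have h4 : Cstar n m * β * (((k + 2) * (E * r ^ 2 * y) + E * r ^ 3 * f₁) / (Cstar n m * q)) =
        β * (((k + 2) * (E * r ^ 2 * y) + E * r ^ 3 * f₁) / q) := by
      field_simp
    rw [h2, h3, h4, hα']
    ring
  have hbot : Tendsto (fun s => exp s) atBot (𝓝[>] 0) := tendsto_exp_atBot_nhdsGT
  have hkbot : Tendsto (fun s => exp (k * s)) atBot (𝓝 0) :=
    tendsto_exp_atBot.comp (tendsto_id.const_mul_atBot hkpos)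
  have hF : Tendsto (fun s => f (exp s) ^ m) atBot (𝓝 (f 0 ^ m)) := by
    have h := (hf.smooth.continuousOn 0 self_mem_Ici).tendsto.mono_left
      (nhdsWithin_mono _ Ioi_subset_Ici_self)
    exact (h.comp hbot).rpow_const (Or.inr hm0.le)
  have hkF : Tendsto (fun s => exp (k * s) * f (exp s) ^ m) atBot (𝓝 0) := by
    simpa using hkbot.mul hF
  refine exists_strictAntiOn_of_profile_ode (p := 1 / m) (A := Cstar n m / (1 - m))
    (B := Cstar n m * β) (b := n - 2 - 2 * k) (γ := γ) (δ := δ) ?_ (by positivity)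
    (by positivity) ?_ hγ hγδ ?_ ?_ ?_ hf.hasDerivAt_logProfile hv₁ hg hode ?_ ?_ ?_
  · rwa [lt_div_iff₀ hm0, one_mul]
  · rw [div_lt_iff₀ ha]
    have := mul_lt_mul_of_pos_left hβγ hC
    linarith
  · rw [hsum, hCa, hk]
    field_simp
    ring
  · rw [hprod, hCa, hk]
    field_simp
  · intro s
    have := hfpos s
    rw [logProfile]
    positivity
  · have h := hkF.div_const q
    rwa [zero_div] at h
  · obtain ⟨l, hl⟩ := hf.tendsto_deriv_rpow
    have h := ((hkF.const_mul k).add (hkbot.mul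
      ((hbot.mono_right nhdsWithin_le_nhds).mul (hl.comp hbot)))).div_const q
    simpa using h
  · have h : Tendsto (fun s => (exp s ^ 2 * f (exp s) ^ (1 - m) / Cstar n m) ^ (m / (1 - m)))
        atTop (𝓝 ((Cstar n m / Cstar n m) ^ (m / (1 - m)))) :=
      ((hf.asymp.comp tendsto_exp_atTop).div_const _).rpow_const (Or.inr (by positivity))
    rw [div_self hC.ne', Real.one_rpow] at h
    exact h.congr fun s => (logProfile_eq_rpow hm1 hC (hfpos s)).symm

end IsProfile

end LogProfile

/-- In logarithmic variables the scaling of profiles is a translation. -/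
theorem rpow_scaled_profile_eq {n : ℕ} {m lam r : ℝ} {f : ℝ → ℝ}
    (hC : 0 < Cstar n m) (hlam : 0 < lam) (hr : 0 < r) (hf : 0 < f (lam * r)) :
    (lam ^ (2 / (1 - m)) * f (lam * r)) ^ m =
      Cstar n m ^ (m / (1 - m)) * r ^ (-(2 * m / (1 - m))) *
        logProfile n m f (log (lam * r)) := by
  have hq : 0 < Cstar n m ^ (m / (1 - m)) := by positivity
  rw [logProfile, exp_log (by positivity), Real.mul_rpow (by positivity) hf.le,
    ← Real.rpow_mul hlam.le, mul_comm (2 * m / (1 - m)) (log _),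
    ← Real.rpow_def_of_pos (by positivity), Real.mul_rpow hlam.le hr.le, Real.rpow_neg hr.le]
  have : 0 < r ^ (2 * m / (1 - m)) := by positivity
  rw [show 2 / (1 - m) * m = 2 * m / (1 - m) by ring]
  field_simp

/-- Under (C2), two profiles with `λ₂ > λ₁` cross: they are ordered one way near the origin,
are equal at some `r₀`, and ordered the other way near infinity. -/
theorem profiles_cross_C2 (n : ℕ) (m β α : ℝ) (hn : 3 ≤ n) (hm0 : 0 < m)
    (hm1 : m < ((n : ℝ) - 2) / n) (hα : α = (2 * β + 1) / (1 - m)) (hC2 : CondC2 n m β)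
    (f : ℝ → ℝ → ℝ) (hf : ∀ lam, 0 < lam → IsProfile n m β α lam (f lam))
    (hscale : ∀ lam, 0 < lam → ∀ r, 0 ≤ r → f lam r = lam ^ (2 / (1 - m)) * f 1 (lam * r)) :
    ∀ lam1 lam2 : ℝ, 0 < lam1 → lam1 < lam2 →
      ∃ r1 r0 r2 : ℝ, 0 < r1 ∧ r1 < r0 ∧ r0 < r2 ∧
        f lam1 r0 = f lam2 r0 ∧
        (∀ r, 0 ≤ r → r < r1 → f lam1 r < f lam2 r) ∧
        (∀ r, r2 < r → f lam2 r < f lam1 r) := by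
  have hn3 : (3 : ℝ) ≤ n := by exact_mod_cast hn
  have hnpos : (0 : ℝ) < n := by linarith
  have hmn : m * n < n - 2 := (lt_div_iff₀ hnpos).1 hm1
  have hm1' : m < 1 := by nlinarith
  have hN : 0 < (n : ℝ) - 2 - n * m := by linarith [mul_comm m (n : ℝ)]
  obtain ⟨h0, h1, h2⟩ := hC2
  have hβ2 : beta2 n m < β := (le_max_left _ _).trans_lt h0
  have hβ : 0 < β := (div_pos hm0 hN).trans ((le_max_right _ _).trans_lt h0)
  have hβN : β * ((n : ℝ) - 2 - n * m) < 1 := (lt_div_iff₀ hN).1 h1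
  have hNm : (n : ℝ) - 2 - n * m < 2 * (1 - m) := by
    rcases h2 with h2 | ⟨-, h2, -⟩
    · have : (n : ℝ) ≤ 4 := by exact_mod_cast h2
      nlinarith
    · rw [div_lt_iff₀ (by linarith)] at h2
      linarith
  have hC := Cstar_pos hm0 hm1' hN
  obtain ⟨S, hS⟩ := (hf 1 one_pos).exists_strictAntiOn_logProfile hm0 hm1' hN hβ hα hβN hNm hβ2
  intro lam1 lam2 hlam1 hlam
  have hlam2 := hlam1.trans hlam
  have hpos1 := (hf lam1 hlam1).pos
  have hpos2 := (hf lam2 hlam2).pos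
  have hfar : ∀ r, exp S / lam1 < r → f lam2 r < f lam1 r := by
    intro r hr
    have hr0 : 0 < r := (by positivity : 0 < exp S / lam1).trans hr
    rw [← Real.rpow_lt_rpow_iff (hpos2 r hr0.le).le (hpos1 r hr0.le).le hm0,
      hscale lam1 hlam1 r hr0.le, hscale lam2 hlam2 r hr0.le,
      rpow_scaled_profile_eq hC hlam1 hr0 ((hf 1 one_pos).pos _ (by positivity)),
      rpow_scaled_profile_eq hC hlam2 hr0 ((hf 1 one_pos).pos _ (by positivity))]
    have hlog : log (lam1 * r) < log (lam2 * r) := log_lt_log (by positivity) (by gcongr)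
    have hSlog : S ≤ log (lam1 * r) := by
      rw [Real.le_log_iff_exp_le (by positivity)]
      rw [div_lt_iff₀' hlam1] at hr
      exact hr.le
    exact mul_lt_mul_of_pos_left (hS hSlog (hSlog.trans hlog.le) hlog) (by positivity)
  have hc1 := (hf lam1 hlam1).smooth.continuousOn
  have hc2 := (hf lam2 hlam2).smooth.continuousOn
  have hinit : f lam1 0 < f lam2 0 := by
    rw [(hf lam1 hlam1).init, (hf lam2 hlam2).init]
    exact Real.rpow_lt_rpow hlam1.le hlam (div_pos two_pos (by linarith))
  obtain ⟨ε, hε, hnear⟩ : ∃ ε > 0, ∀ r, 0 ≤ r → r < ε → f lam1 r < f lam2 r := by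
    have h := (hc1 0 self_mem_Ici).eventually_lt (hc2 0 self_mem_Ici) hinit
    obtain ⟨ε, hε, h⟩ := Metric.mem_nhdsWithin_iff.1 h
    refine ⟨ε, hε, fun r hr hrε => h ⟨?_, hr⟩⟩
    rwa [Metric.mem_ball, Real.dist_0_eq_abs, abs_of_nonneg hr]
  set R := exp S / lam1 + 1
  have hRpos : 0 < R := by positivity
  have hR := hfar R (lt_add_one _)
  have hsub : Icc 0 R ⊆ Ici (0 : ℝ) := Icc_subset_Ici_self
  obtain ⟨r0, hr0, heq⟩ : ∃ r0 ∈ Icc 0 R, f lam2 r0 - f lam1 r0 = 0 :=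
    intermediate_value_Icc' hRpos.le ((hc2.mono hsub).sub (hc1.mono hsub))
      ⟨(sub_neg.2 hR).le, (sub_pos.2 hinit).le⟩
  have hεr0 : ε ≤ r0 := by
    by_contra! h
    have := hnear r0 hr0.1 h
    linarith
  have hr0R : r0 < R := hr0.2.lt_of_ne fun h => by
    rw [h] at heq
    linarith
  exact ⟨ε / 2, r0, R, by positivity, by linarith, hr0R, (sub_eq_zero.1 heq).symm,
    fun r hr hrε => hnear r hr (by linarith), fun r hr => hfar r ((lt_add_one _).trans hr)⟩
end
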